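/- arXiv:1704.00715 — 2 statements merged into one kernel-verified Lean document; each statement's English description precedes it below -/
import Mathlib

section
/- For any BMSC W with finite output alphabet, the plus bulk convolutional polar transform satisfies Z(W^{+̂}) = Z(W⁻)·Z(W⁺), and consequently Z(W^{+̂}) ≤ 2·Z(W)³. -/
open Finset

section Channels

variable {Y Y₁ Y₂ : Type*}

/-- A binary-input channel with finite output alphabet: nonnegative entries,
each row summing to one. -/
def IsChannel [Fintype Y] (W : ZMod 2 → Y → ℝ) : Prop :=
  (∀ x y, 0 ≤ W x y) ∧ ∀ x, ∑ y, W x y = 1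

/-- A binary-input memoryless symmetric channel (BMSC): a channel admitting an
involution of the output alphabet exchanging the two conditional distributions. -/
def IsBMSC [Fintype Y] (W : ZMod 2 → Y → ℝ) : Prop :=
  IsChannel W ∧ ∃ π : Y → Y, Function.Involutive π ∧ ∀ y, W 1 y = W 0 (π y)

/-- The Bhattacharyya parameter of a binary-input channel. -/
noncomputable def Zparam [Fintype Y] (W : ZMod 2 → Y → ℝ) : ℝ :=
  ∑ y, Real.sqrt (W 0 y * W 1 y)

/-- The symmetric capacity of a binary-input channel. -/
noncomputable def capacity [Fintype Y] (W : ZMod 2 → Y → ℝ) : ℝ :=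
  ∑ x : ZMod 2, ∑ y, (1 / 2) * W x y *
    Real.logb 2 (W x y / ((1 / 2) * (W 0 y + W 1 y)))

/-- The minus polar transform ⟨W₁,W₂⟩⁻. -/
noncomputable def polarMinus [Fintype Y₁] [Fintype Y₂] (W₁ : ZMod 2 → Y₁ → ℝ)
    (W₂ : ZMod 2 → Y₂ → ℝ) : ZMod 2 → Y₁ × Y₂ → ℝ :=
  fun u₁ y => (1 / 2) * ∑ u₂ : ZMod 2, W₁ (u₁ + u₂) y.1 * W₂ u₂ y.2

/-- The plus polar transform ⟨W₁,W₂⟩⁺, with output (y₁, y₂, u₁). -/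
noncomputable def polarPlus [Fintype Y₁] [Fintype Y₂] (W₁ : ZMod 2 → Y₁ → ℝ)
    (W₂ : ZMod 2 → Y₂ → ℝ) : ZMod 2 → Y₁ × Y₂ × ZMod 2 → ℝ :=
  fun u₂ y => (1 / 2) * W₁ (y.2.2 + u₂) y.1 * W₂ u₂ y.2.1

end Channels

/-- The minus bulk convolutional polar transform W^{-̂} = ⟨W⁻, W⁺⟩⁻. -/
noncomputable def convMinus {Y : Type*} [Fintype Y] (W : ZMod 2 → Y → ℝ) :
    ZMod 2 → (Y × Y) × (Y × Y × ZMod 2) → ℝ :=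
  polarMinus (polarMinus W W) (polarPlus W W)

/-- The plus bulk convolutional polar transform W^{+̂} = ⟨W⁻, W⁺⟩⁺. -/
noncomputable def convPlus {Y : Type*} [Fintype Y] (W : ZMod 2 → Y → ℝ) :
    ZMod 2 → (Y × Y) × (Y × Y × ZMod 2) × ZMod 2 → ℝ :=
  polarPlus (polarMinus W W) (polarPlus W W)

/-- The Bhattacharyya parameter is multiplicative under the plus polar transform. -/
theorem Zparam_polarPlus {Y₁ Y₂ : Type*} [Fintype Y₁] [Fintype Y₂]
    (W₁ : ZMod 2 → Y₁ → ℝ) (W₂ : ZMod 2 → Y₂ → ℝ) (h₁ : ∀ x y, 0 ≤ W₁ x y) :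
    Zparam (polarPlus W₁ W₂) = Zparam W₁ * Zparam W₂ := by
  have key (y₁ : Y₁) (y₂ : Y₂) (u : ZMod 2) :
      Real.sqrt (polarPlus W₁ W₂ 0 (y₁, y₂, u) * polarPlus W₁ W₂ 1 (y₁, y₂, u)) =
        1 / 2 * (Real.sqrt (W₁ 0 y₁ * W₁ 1 y₁) * Real.sqrt (W₂ 0 y₂ * W₂ 1 y₂)) := by
    have hu : W₁ (u + 0) y₁ * W₁ (u + 1) y₁ = W₁ 0 y₁ * W₁ 1 y₁ := by
      have hu' : u = 0 ∨ u = 1 := by decide +revert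
      rcases hu' with rfl | rfl
      · simp
      · rw [add_zero, CharTwo.add_self_eq_zero, mul_comm]
    have hprod : polarPlus W₁ W₂ 0 (y₁, y₂, u) * polarPlus W₁ W₂ 1 (y₁, y₂, u) =
        (1 / 2) ^ 2 * ((W₁ 0 y₁ * W₁ 1 y₁) * (W₂ 0 y₂ * W₂ 1 y₂)) := by
      rw [← hu]
      simp only [polarPlus]
      ring
    rw [hprod, Real.sqrt_mul (by positivity), Real.sqrt_sq (by norm_num),
      Real.sqrt_mul (mul_nonneg (h₁ 0 y₁) (h₁ 1 y₁))]
  simp only [Zparam, Fintype.sum_prod_type, key, sum_const, card_univ, ZMod.card,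
    sum_mul_sum, nsmul_eq_mul]
  refine sum_congr rfl fun _ _ => sum_congr rfl fun _ _ => ?_
  push_cast
  ring

theorem sqrt_mul_add_mul_le {a b c d : ℝ} (ha : 0 ≤ a) (hb : 0 ≤ b) (hc : 0 ≤ c)
    (hd : 0 ≤ d) :
    Real.sqrt ((a * c + b * d) * (b * c + a * d)) ≤
      Real.sqrt (a * b) * (c + d) + Real.sqrt (c * d) * (a + b) := by
  apply Real.sqrt_le_iff.mpr
  refine ⟨by positivity, ?_⟩
  have hab := Real.sq_sqrt (mul_nonneg ha hb)
  have hcd := Real.sq_sqrt (mul_nonneg hc hd)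
  have hcross : 0 ≤ Real.sqrt (a * b) * (c + d) * (Real.sqrt (c * d) * (a + b)) := by
    positivity
  have habcd : 0 ≤ a * b * (c * d) := by positivity
  have hexp : (Real.sqrt (a * b) * (c + d) + Real.sqrt (c * d) * (a + b)) ^ 2 =
      a * b * (c + d) ^ 2 + c * d * (a + b) ^ 2 +
        2 * (Real.sqrt (a * b) * (c + d) * (Real.sqrt (c * d) * (a + b))) := by
    rw [add_sq, mul_pow, mul_pow, hab, hcd]
    ring
  rw [hexp]
  linarith

theorem polarMinus_nonneg {Y₁ Y₂ : Type*} [Fintype Y₁] [Fintype Y₂]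
    {W₁ : ZMod 2 → Y₁ → ℝ} {W₂ : ZMod 2 → Y₂ → ℝ} (h₁ : ∀ x y, 0 ≤ W₁ x y)
    (h₂ : ∀ x y, 0 ≤ W₂ x y) (x : ZMod 2) (y : Y₁ × Y₂) : 0 ≤ polarMinus W₁ W₂ x y :=
  mul_nonneg (by norm_num) (sum_nonneg fun _ _ => mul_nonneg (h₁ _ _) (h₂ _ _))

/-- The minus polar transform satisfies the union-type bound `Z(⟨W₁,W₂⟩⁻) ≤ Z(W₁) + Z(W₂)`. -/
theorem Zparam_polarMinus_le {Y₁ Y₂ : Type*} [Fintype Y₁] [Fintype Y₂]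
    {W₁ : ZMod 2 → Y₁ → ℝ} {W₂ : ZMod 2 → Y₂ → ℝ} (h₁ : IsChannel W₁)
    (h₂ : IsChannel W₂) :
    Zparam (polarMinus W₁ W₂) ≤ Zparam W₁ + Zparam W₂ := by
  have key (y₁ : Y₁) (y₂ : Y₂) :
      Real.sqrt (polarMinus W₁ W₂ 0 (y₁, y₂) * polarMinus W₁ W₂ 1 (y₁, y₂)) ≤
        1 / 2 * (Real.sqrt (W₁ 0 y₁ * W₁ 1 y₁) * (W₂ 0 y₂ + W₂ 1 y₂) +
          Real.sqrt (W₂ 0 y₂ * W₂ 1 y₂) * (W₁ 0 y₁ + W₁ 1 y₁)) := by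
    have hsum (f : ZMod 2 → ℝ) : ∑ u, f u = f 0 + f 1 := Fin.sum_univ_two f
    have hprod : polarMinus W₁ W₂ 0 (y₁, y₂) * polarMinus W₁ W₂ 1 (y₁, y₂) =
        (1 / 2) ^ 2 * ((W₁ 0 y₁ * W₂ 0 y₂ + W₁ 1 y₁ * W₂ 1 y₂) *
          (W₁ 1 y₁ * W₂ 0 y₂ + W₁ 0 y₁ * W₂ 1 y₂)) := by
      simp only [polarMinus, hsum, zero_add, add_zero, CharTwo.add_self_eq_zero]
      ring
    rw [hprod, Real.sqrt_mul (by positivity), Real.sqrt_sq (by norm_num)]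
    gcongr
    exact sqrt_mul_add_mul_le (h₁.1 0 y₁) (h₁.1 1 y₁) (h₂.1 0 y₂) (h₂.1 1 y₂)
  calc Zparam (polarMinus W₁ W₂)
      ≤ ∑ y₁, ∑ y₂, 1 / 2 * (Real.sqrt (W₁ 0 y₁ * W₁ 1 y₁) * (W₂ 0 y₂ + W₂ 1 y₂) +
          Real.sqrt (W₂ 0 y₂ * W₂ 1 y₂) * (W₁ 0 y₁ + W₁ 1 y₁)) := by
        rw [Zparam, Fintype.sum_prod_type]
        exact sum_le_sum fun y₁ _ => sum_le_sum fun y₂ _ => key y₁ y₂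
    _ = Zparam W₁ + Zparam W₂ := by
        simp only [← mul_sum, sum_add_distrib, ← sum_mul, h₁.2, h₂.2, Zparam]
        ring

/-- for any BMSC W, Z(W^{+̂}) = Z(W⁻)·Z(W⁺), and consequently
Z(W^{+̂}) ≤ 2·Z(W)³. -/
theorem Zparam_convPlus {Y : Type*} [Fintype Y] (W : ZMod 2 → Y → ℝ)
    (hW : IsBMSC W) :
    Zparam (convPlus W) = Zparam (polarMinus W W) * Zparam (polarPlus W W) ∧
    Zparam (convPlus W) ≤ 2 * Zparam W ^ 3 := by
  have hminus := polarMinus_nonneg hW.1.1 hW.1.1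
  have hZ := Zparam_polarPlus (polarMinus W W) (polarPlus W W) hminus
  refine ⟨hZ, ?_⟩
  calc Zparam (convPlus W) = Zparam (polarMinus W W) * Zparam W ^ 2 := by
        rw [convPlus, hZ, Zparam_polarPlus W W hW.1.1, sq]
    _ ≤ (Zparam W + Zparam W) * Zparam W ^ 2 := by
        gcongr
        exact Zparam_polarMinus_le hW.1 hW.1
    _ = 2 * Zparam W ^ 3 := by ring
end

section
/- (Mrs. Gerber's Lemma for the polar transform.) Let W₁ and W₂ be BMSCs with finite output alphabets and let p₁, p₂ ∈ [0, 1/2] satisfy I(W₁) = 1 − h₂(p₁) and I(W₂) = 1 − h₂(p₂). Then I(⟨W₁,W₂⟩⁻) ≤ 1 − h₂(p₁ * p₂), where p₁ * p₂ = p₁(1−p₂) + (1−p₁)p₂. -/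
open Finset

/-- The binary entropy function (in bits). -/
noncomputable def h2 (p : ℝ) : ℝ :=
  -p * Real.logb 2 p - (1 - p) * Real.logb 2 (1 - p)

section GerberAuxiliary

/-- The loss of binary entropy (in nats) at bias `t`: `log 2 - h((1 - t) / 2)`. -/
noncomputable def biasInfo (t : ℝ) : ℝ :=
  ((1 + t) * Real.log (1 + t) + (1 - t) * Real.log (1 - t)) / 2

/-- The inverse hyperbolic tangent in logarithmic form, the derivative of `biasInfo`. -/
noncomputable def biasSlope (t : ℝ) : ℝ :=
  (Real.log (1 + t) - Real.log (1 - t)) / 2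

lemma continuous_biasInfo : Continuous biasInfo := by
  unfold biasInfo
  have h₁ : Continuous fun t : ℝ => (1 + t) * Real.log (1 + t) :=
    Real.continuous_mul_log.comp (continuous_const.add continuous_id)
  have h₂ : Continuous fun t : ℝ => (1 - t) * Real.log (1 - t) :=
    Real.continuous_mul_log.comp (continuous_const.sub continuous_id)
  exact (h₁.add h₂).div_const 2

lemma biasInfo_neg (t : ℝ) : biasInfo (-t) = biasInfo t := by
  simp only [biasInfo, sub_neg_eq_add, ← sub_eq_add_neg]
  ring

lemma biasInfo_abs (t : ℝ) : biasInfo |t| = biasInfo t := by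
  rcases abs_choice t with h | h <;> simp [h, biasInfo_neg]

@[simp] lemma biasInfo_zero : biasInfo 0 = 0 := by simp [biasInfo]

lemma hasDerivAt_biasInfo {t : ℝ} (h₀ : 0 ≤ t) (h₁ : t < 1) :
    HasDerivAt biasInfo (biasSlope t) t := by
  have ha : HasDerivAt (fun t : ℝ => 1 + t) 1 t := (hasDerivAt_id t).const_add 1
  have hb : HasDerivAt (fun t : ℝ => 1 - t) (-1) t := (hasDerivAt_id t).const_sub 1
  have h₂ : (1 + t) ≠ 0 := by linarith
  have h₃ : (1 - t) ≠ 0 := by linarith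
  have := ((ha.mul (ha.log h₂)).add (hb.mul (hb.log h₃))).div_const 2
  refine this.congr_deriv ?_
  unfold biasSlope
  field_simp
  ring

lemma hasDerivAt_biasSlope {t : ℝ} (h₀ : 0 ≤ t) (h₁ : t < 1) :
    HasDerivAt biasSlope (1 / (1 - t ^ 2)) t := by
  have ha : HasDerivAt (fun t : ℝ => 1 + t) 1 t := (hasDerivAt_id t).const_add 1
  have hb : HasDerivAt (fun t : ℝ => 1 - t) (-1) t := (hasDerivAt_id t).const_sub 1
  have h₂ : (1 + t) ≠ 0 := by linarith
  have h₃ : (1 - t) ≠ 0 := by linarith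
  have h₄ : (1 - t ^ 2) ≠ 0 := by
    rw [show 1 - t ^ 2 = (1 + t) * (1 - t) by ring]; exact mul_ne_zero h₂ h₃
  have := ((ha.log h₂).sub (hb.log h₃)).div_const 2
  refine this.congr_deriv ?_
  field_simp
  ring

lemma le_biasSlope {t : ℝ} (h₀ : 0 ≤ t) (h₁ : t < 1) : t ≤ biasSlope t := by
  have hd : ∀ x ∈ Set.Ico (0 : ℝ) 1,
      HasDerivAt (fun x => biasSlope x - x) (1 / (1 - x ^ 2) - 1) x := fun x hx =>
    (hasDerivAt_biasSlope hx.1 hx.2).sub (hasDerivAt_id x)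
  have hm : MonotoneOn (fun x => biasSlope x - x) (Set.Ico 0 1) := by
    refine monotoneOn_of_deriv_nonneg (convex_Ico 0 1)
      (fun x hx => (hd x hx).continuousAt.continuousWithinAt)
      (fun x hx => (hd x (interior_subset hx)).differentiableAt.differentiableWithinAt) ?_
    intro x hx
    have hx' := interior_subset hx
    rw [(hd x hx').deriv, sub_nonneg, one_le_div (by nlinarith [hx'.1, hx'.2])]
    nlinarith [sq_nonneg x]
  have := hm ⟨le_rfl, one_pos⟩ ⟨h₀, h₁⟩ h₀
  simp only [biasSlope, add_zero, sub_zero, Real.log_one, zero_div] at this ⊢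
  linarith

lemma monotoneOn_biasInfo : MonotoneOn biasInfo (Set.Icc 0 1) := by
  refine monotoneOn_of_deriv_nonneg (convex_Icc 0 1) continuous_biasInfo.continuousOn ?_ ?_
  all_goals rw [interior_Icc]
  · exact fun x hx =>
      (hasDerivAt_biasInfo hx.1.le hx.2).differentiableAt.differentiableWithinAt
  · intro x hx
    rw [(hasDerivAt_biasInfo hx.1.le hx.2).deriv]
    exact hx.1.le.trans (le_biasSlope hx.1.le hx.2)

lemma antitoneOn_one_sub_sq_mul_biasSlope_div :
    AntitoneOn (fun x => (1 - x ^ 2) * biasSlope x / x) (Set.Ioo 0 1) := by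
  have hd : ∀ x ∈ Set.Ioo (0 : ℝ) 1, HasDerivAt (fun x => (1 - x ^ 2) * biasSlope x / x)
      ((x - (1 + x ^ 2) * biasSlope x) / x ^ 2) x := by
    intro x hx
    have hs : HasDerivAt (fun x : ℝ => 1 - x ^ 2) (-(2 * x)) x := by
      simpa using (hasDerivAt_pow 2 x).const_sub 1
    have h₁ : (1 - x ^ 2) ≠ 0 := by nlinarith [hx.1, hx.2]
    have := (hs.mul (hasDerivAt_biasSlope hx.1.le hx.2)).div (hasDerivAt_id x) hx.1.ne'
    refine this.congr_deriv ?_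
    simp only [id, Pi.mul_apply]
    rw [mul_one_div_cancel h₁]
    ring
  refine antitoneOn_of_deriv_nonpos (convex_Ioo 0 1)
    (fun x hx => (hd x hx).continuousAt.continuousWithinAt)
    (fun x hx => (hd x (interior_subset hx)).differentiableAt.differentiableWithinAt) ?_
  intro x hx
  have hx' := interior_subset hx
  rw [(hd x hx').deriv]
  have := le_biasSlope hx'.1.le hx'.2
  exact div_nonpos_of_nonpos_of_nonneg
    (by nlinarith [mul_nonneg (sq_nonneg x) (hx'.1.le.trans this)]) (sq_nonneg x)

lemma antitoneOn_biasSlope_mul_div {a : ℝ} (ha₀ : 0 < a) (ha₁ : a ≤ 1) :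
    AntitoneOn (fun x => biasSlope (a * x) / biasSlope x) (Set.Ioo 0 1) := by
  have hpos : ∀ x ∈ Set.Ioo (0 : ℝ) 1, 0 < biasSlope x := fun x hx =>
    hx.1.trans_le (le_biasSlope hx.1.le hx.2)
  have hmem : ∀ x ∈ Set.Ioo (0 : ℝ) 1, a * x ∈ Set.Ioo (0 : ℝ) 1 := fun x hx =>
    ⟨mul_pos ha₀ hx.1, by nlinarith [hx.1, hx.2]⟩
  have hd : ∀ x ∈ Set.Ioo (0 : ℝ) 1, HasDerivAt (fun x => biasSlope (a * x) / biasSlope x)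
      ((1 / (1 - (a * x) ^ 2) * a * biasSlope x - biasSlope (a * x) * (1 / (1 - x ^ 2))) /
        biasSlope x ^ 2) x := by
    intro x hx
    have hm : HasDerivAt (fun x : ℝ => a * x) a x := by
      simpa using (hasDerivAt_id x).const_mul a
    have hc := (hasDerivAt_biasSlope (hmem x hx).1.le (hmem x hx).2).comp x hm
    exact hc.div (hasDerivAt_biasSlope hx.1.le hx.2) (hpos x hx).ne'
  refine antitoneOn_of_deriv_nonpos (convex_Ioo 0 1)
    (fun x hx => (hd x hx).continuousAt.continuousWithinAt)
    (fun x hx => (hd x (interior_subset hx)).differentiableAt.differentiableWithinAt) ?_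
  intro x hx
  have hx' := interior_subset hx
  have hax := hmem x hx'
  rw [(hd x hx').deriv]
  refine div_nonpos_of_nonpos_of_nonneg ?_ (sq_nonneg _)
  have hK := antitoneOn_one_sub_sq_mul_biasSlope_div hax hx' (by nlinarith [hx'.1])
  have h₁ : 0 < 1 - x ^ 2 := by nlinarith [hx'.1, hx'.2]
  have h₂ : 0 < 1 - (a * x) ^ 2 := by nlinarith [hax.1, hax.2]
  have hx₀ := hx'.1
  simp only at hK
  rw [div_le_div_iff₀ hx₀ hax.1] at hK
  have hK' : (1 - x ^ 2) * biasSlope x * a ≤ (1 - (a * x) ^ 2) * biasSlope (a * x) := by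
    refine le_of_mul_le_mul_right ?_ hx₀
    linarith
  rw [sub_nonpos, mul_one_div, one_div, mul_assoc, ← div_eq_inv_mul, div_le_div_iff₀ h₂ h₁]
  linarith

/-- Supporting-line form of the concavity of `biasInfo t ↦ biasInfo (a * t)`. -/
lemma exists_biasInfo_mul_sub_le {a s : ℝ} (ha : a ∈ Set.Icc (0 : ℝ) 1)
    (hs : s ∈ Set.Icc (0 : ℝ) 1) :
    ∃ c : ℝ, ∀ t ∈ Set.Icc (0 : ℝ) 1,
      biasInfo (a * t) - biasInfo (a * s) ≤ c * (biasInfo t - biasInfo s) := by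
  have hmul : ∀ x ∈ Set.Icc (0 : ℝ) 1, a * x ∈ Set.Icc (0 : ℝ) 1 := fun x hx =>
    ⟨mul_nonneg ha.1 hx.1, mul_le_one₀ ha.2 hx.1 hx.2⟩
  rcases ha.1.eq_or_lt with rfl | ha₀
  · exact ⟨0, fun t _ => by simp⟩
  rcases hs.1.eq_or_lt with rfl | hs₀
  · refine ⟨1, fun t ht => ?_⟩
    have := monotoneOn_biasInfo (hmul t ht) ht (mul_le_of_le_one_left ht.1 ha.2)
    simpa using this
  rcases hs.2.eq_or_lt with rfl | hs₁
  · refine ⟨0, fun t ht => ?_⟩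
    have := monotoneOn_biasInfo (hmul t ht) (hmul 1 hs)
      (mul_le_mul_of_nonneg_left ht.2 ha.1)
    linarith
  have hpos : ∀ x ∈ Set.Ioo (0 : ℝ) 1, 0 < biasSlope x := fun x hx =>
    hx.1.trans_le (le_biasSlope hx.1.le hx.2)
  set r : ℝ → ℝ := fun x => biasSlope (a * x) / biasSlope x
  have hanti := antitoneOn_biasSlope_mul_div ha₀ ha.2
  set D : ℝ → ℝ := fun t => a * r s * biasInfo t - biasInfo (a * t) with hD
  have hcont : Continuous D :=
    (continuous_const.mul continuous_biasInfo).sub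
      (continuous_biasInfo.comp (continuous_const.mul continuous_id))
  have hd : ∀ x ∈ Set.Ioo (0 : ℝ) 1,
      HasDerivAt D (a * biasSlope x * (r s - r x)) x := by
    intro x hx
    have hm : HasDerivAt (fun x : ℝ => a * x) a x := by
      simpa using (hasDerivAt_id x).const_mul a
    have hax : a * x < 1 := by nlinarith [hx.1, hx.2, ha.2]
    have hc := (hasDerivAt_biasInfo (mul_pos ha₀ hx.1).le hax).comp x hm
    have := ((hasDerivAt_biasInfo hx.1.le hx.2).const_mul (a * r s)).sub hc
    refine this.congr_deriv ?_
    have hb : biasSlope x * r x = biasSlope (a * x) := mul_div_cancel₀ _ (hpos x hx).ne'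
    rw [← hb]
    ring
  have hmin : ∀ t ∈ Set.Icc (0 : ℝ) 1, D s ≤ D t := by
    intro t ht
    rcases le_total t s with hts | hst
    · have hA : AntitoneOn D (Set.Icc 0 s) := by
        refine antitoneOn_of_deriv_nonpos (convex_Icc 0 s) hcont.continuousOn ?_ ?_
        all_goals
          rw [interior_Icc]
          intro x hx
          have hx' : x ∈ Set.Ioo (0 : ℝ) 1 := ⟨hx.1, hx.2.trans hs₁⟩
        · exact (hd x hx').differentiableAt.differentiableWithinAt
        · rw [(hd x hx').deriv]
          exact mul_nonpos_of_nonneg_of_nonpos (mul_pos ha₀ (hpos x hx')).le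
            (sub_nonpos.2 (hanti hx' ⟨hs₀, hs₁⟩ hx.2.le))
      exact hA ⟨ht.1, hts⟩ ⟨hs.1, le_rfl⟩ hts
    · have hM : MonotoneOn D (Set.Icc s 1) := by
        refine monotoneOn_of_deriv_nonneg (convex_Icc s 1) hcont.continuousOn ?_ ?_
        all_goals
          rw [interior_Icc]
          intro x hx
          have hx' : x ∈ Set.Ioo (0 : ℝ) 1 := ⟨hs₀.trans hx.1, hx.2⟩
        · exact (hd x hx').differentiableAt.differentiableWithinAt
        · rw [(hd x hx').deriv]
          exact mul_nonneg (mul_pos ha₀ (hpos x hx')).le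
            (sub_nonneg.2 (hanti ⟨hs₀, hs₁⟩ hx' hx.1.le))
      exact hM ⟨le_rfl, hs.2⟩ ⟨hst, ht.2⟩ hst
  refine ⟨a * r s, fun t ht => ?_⟩
  have := hmin t ht
  simp only [hD] at this
  linarith

/-- Jensen's inequality for `biasInfo t ↦ biasInfo (a * t)`. -/
lemma sum_mul_biasInfo_mul_le {Y : Type*} [Fintype Y] {w t : Y → ℝ} {a s : ℝ}
    (hw : ∀ y, 0 ≤ w y) (hw₁ : ∑ y, w y = 1) (ht : ∀ y, |t y| ≤ 1)
    (ha : |a| ≤ 1) (hs : s ∈ Set.Icc (0 : ℝ) 1)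
    (hsum : ∑ y, w y * biasInfo (t y) = biasInfo s) :
    ∑ y, w y * biasInfo (a * t y) ≤ biasInfo (a * s) := by
  obtain ⟨c, hc⟩ := exists_biasInfo_mul_sub_le ⟨abs_nonneg a, ha⟩ hs
  have has : biasInfo (a * s) = biasInfo (|a| * s) := by
    rw [← biasInfo_abs (a * s), abs_mul, abs_of_nonneg hs.1]
  calc ∑ y, w y * biasInfo (a * t y)
      ≤ ∑ y, (w y * biasInfo (a * s) + (c * (w y * biasInfo (t y)) - c * biasInfo s * w y)) := by
        refine sum_le_sum fun y _ => ?_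
        have h := mul_le_mul_of_nonneg_left (hc |t y| ⟨abs_nonneg _, ht y⟩) (hw y)
        rw [← abs_mul, biasInfo_abs, biasInfo_abs, ← has] at h
        linarith
    _ = biasInfo (a * s) := by
        rw [sum_add_distrib, sum_sub_distrib, ← sum_mul, ← mul_sum, ← mul_sum, hw₁, hsum]
        ring

lemma one_sub_h2_mul_log_two {p : ℝ} (hp₀ : 0 ≤ p) (hp₁ : p < 1) :
    (1 - h2 p) * Real.log 2 = biasInfo (1 - 2 * p) := by
  have hl : Real.log 2 ≠ 0 := (Real.log_pos one_lt_two).ne'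
  have hq : Real.log (1 + (1 - 2 * p)) = Real.log 2 + Real.log (1 - p) := by
    rw [← Real.log_mul two_ne_zero (by linarith)]
    ring_nf
  unfold h2 biasInfo Real.logb
  rw [hq, sub_sub_cancel]
  rcases hp₀.eq_or_lt with rfl | hp
  · simp
    ring
  · rw [Real.log_mul two_ne_zero hp.ne']
    field_simp
    ring

/-- The probability of an output letter under uniform input. -/
noncomputable def outputWeight {Y : Type*} (W : ZMod 2 → Y → ℝ) (y : Y) : ℝ :=
  (W 0 y + W 1 y) / 2

/-- The difference of the posterior input probabilities given an output letter. -/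
noncomputable def posteriorBias {Y : Type*} (W : ZMod 2 → Y → ℝ) (y : Y) : ℝ :=
  (W 0 y - W 1 y) / (W 0 y + W 1 y)

lemma sum_zmod_two (f : ZMod 2 → ℝ) : ∑ x, f x = f 0 + f 1 := Fin.sum_univ_two f

lemma capacity_mul_log_two {Y : Type*} [Fintype Y] {W : ZMod 2 → Y → ℝ}
    (hW : ∀ x y, 0 ≤ W x y) :
    capacity W * Real.log 2 = ∑ y, outputWeight W y * biasInfo (posteriorBias W y) := by
  have hl : Real.log 2 ≠ 0 := (Real.log_pos one_lt_two).ne'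
  rw [capacity, sum_zmod_two, ← sum_add_distrib, sum_mul]
  refine sum_congr rfl fun y _ => ?_
  have h₀ := hW 0 y
  have h₁ := hW 1 y
  rcases (add_nonneg h₀ h₁).eq_or_lt with h | h
  · have e₀ : W 0 y = 0 := by linarith
    have e₁ : W 1 y = 0 := by linarith
    simp [outputWeight, e₀, e₁]
  · have r₀ : W 0 y / (1 / 2 * (W 0 y + W 1 y)) = 1 + posteriorBias W y := by
      unfold posteriorBias; field_simp; ring
    have r₁ : W 1 y / (1 / 2 * (W 0 y + W 1 y)) = 1 - posteriorBias W y := by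
      unfold posteriorBias; field_simp; ring
    have m₀ : W 0 y = outputWeight W y * (1 + posteriorBias W y) := by
      unfold posteriorBias outputWeight; field_simp; ring
    have m₁ : W 1 y = outputWeight W y * (1 - posteriorBias W y) := by
      unfold posteriorBias outputWeight; field_simp; ring
    rw [r₀, r₁, m₀, m₁, biasInfo, Real.logb, Real.logb]
    field_simp

lemma outputWeight_nonneg {Y : Type*} {W : ZMod 2 → Y → ℝ} (hW : ∀ x y, 0 ≤ W x y) (y : Y) :
    0 ≤ outputWeight W y :=
  div_nonneg (add_nonneg (hW 0 y) (hW 1 y)) zero_le_two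

lemma sum_outputWeight {Y : Type*} [Fintype Y] {W : ZMod 2 → Y → ℝ} (hW : IsChannel W) :
    ∑ y, outputWeight W y = 1 := by
  simp only [outputWeight]
  rw [← sum_div, sum_add_distrib, hW.2, hW.2]
  norm_num

lemma abs_posteriorBias_le_one {Y : Type*} {W : ZMod 2 → Y → ℝ} (hW : ∀ x y, 0 ≤ W x y)
    (y : Y) : |posteriorBias W y| ≤ 1 := by
  have h₀ := hW 0 y
  have h₁ := hW 1 y
  rw [posteriorBias, abs_div, abs_of_nonneg (add_nonneg h₀ h₁)]
  exact div_le_one_of_le₀ (abs_le.2 ⟨by linarith, by linarith⟩) (add_nonneg h₀ h₁)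

lemma polarMinus_zero {Y₁ Y₂ : Type*} [Fintype Y₁] [Fintype Y₂] (W₁ : ZMod 2 → Y₁ → ℝ)
    (W₂ : ZMod 2 → Y₂ → ℝ) (y : Y₁ × Y₂) :
    polarMinus W₁ W₂ 0 y = 1 / 2 * (W₁ 0 y.1 * W₂ 0 y.2 + W₁ 1 y.1 * W₂ 1 y.2) := by
  rw [polarMinus, sum_zmod_two, zero_add, zero_add]

lemma polarMinus_one {Y₁ Y₂ : Type*} [Fintype Y₁] [Fintype Y₂] (W₁ : ZMod 2 → Y₁ → ℝ)
    (W₂ : ZMod 2 → Y₂ → ℝ) (y : Y₁ × Y₂) :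
    polarMinus W₁ W₂ 1 y = 1 / 2 * (W₁ 1 y.1 * W₂ 0 y.2 + W₁ 0 y.1 * W₂ 1 y.2) := by
  rw [polarMinus, sum_zmod_two, add_zero, show (1 + 1 : ZMod 2) = 0 from rfl]

lemma outputWeight_polarMinus {Y₁ Y₂ : Type*} [Fintype Y₁] [Fintype Y₂]
    (W₁ : ZMod 2 → Y₁ → ℝ) (W₂ : ZMod 2 → Y₂ → ℝ) (y : Y₁ × Y₂) :
    outputWeight (polarMinus W₁ W₂) y = outputWeight W₁ y.1 * outputWeight W₂ y.2 := by
  rw [outputWeight, polarMinus_zero, polarMinus_one, outputWeight, outputWeight]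
  ring

lemma posteriorBias_polarMinus {Y₁ Y₂ : Type*} [Fintype Y₁] [Fintype Y₂]
    (W₁ : ZMod 2 → Y₁ → ℝ) (W₂ : ZMod 2 → Y₂ → ℝ) (y : Y₁ × Y₂) :
    posteriorBias (polarMinus W₁ W₂) y = posteriorBias W₁ y.1 * posteriorBias W₂ y.2 := by
  rw [posteriorBias, polarMinus_zero, polarMinus_one, posteriorBias, posteriorBias,
    div_mul_div_comm, ← mul_div_mul_left _ _ (two_ne_zero (α := ℝ))]
  ring_nf

end GerberAuxiliary

/-- Mrs. Gerber's Lemma for the polar transform: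
if I(W₁) = 1 − h₂(p₁) and I(W₂) = 1 − h₂(p₂) with p₁, p₂ ∈ [0,1/2], then
I(⟨W₁,W₂⟩⁻) ≤ 1 − h₂(p₁ * p₂) where p₁ * p₂ = p₁(1−p₂) + (1−p₁)p₂. -/
theorem mrs_gerber_polarMinus {Y₁ Y₂ : Type*} [Fintype Y₁] [Fintype Y₂]
    (W₁ : ZMod 2 → Y₁ → ℝ) (W₂ : ZMod 2 → Y₂ → ℝ)
    (hW₁ : IsBMSC W₁) (hW₂ : IsBMSC W₂) (p₁ p₂ : ℝ)
    (hp₁ : p₁ ∈ Set.Icc (0 : ℝ) (1 / 2)) (hp₂ : p₂ ∈ Set.Icc (0 : ℝ) (1 / 2))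
    (hI₁ : capacity W₁ = 1 - h2 p₁) (hI₂ : capacity W₂ = 1 - h2 p₂) :
    capacity (polarMinus W₁ W₂) ≤ 1 - h2 (p₁ * (1 - p₂) + (1 - p₁) * p₂) := by
  obtain ⟨hp₁₀, hp₁₁⟩ := hp₁
  obtain ⟨hp₂₀, hp₂₁⟩ := hp₂
  have hc₁ := hW₁.1
  have hc₂ := hW₂.1
  have hs₁ : 1 - 2 * p₁ ∈ Set.Icc (0 : ℝ) 1 := ⟨by linarith, by linarith⟩
  have hs₂ : 1 - 2 * p₂ ∈ Set.Icc (0 : ℝ) 1 := ⟨by linarith, by linarith⟩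
  have hsum₁ : ∑ y, outputWeight W₁ y * biasInfo (posteriorBias W₁ y) =
      biasInfo (1 - 2 * p₁) := by
    rw [← capacity_mul_log_two hc₁.1, hI₁, one_sub_h2_mul_log_two hp₁₀ (by linarith)]
  have hsum₂ : ∑ y, outputWeight W₂ y * biasInfo (posteriorBias W₂ y) =
      biasInfo (1 - 2 * p₂) := by
    rw [← capacity_mul_log_two hc₂.1, hI₂, one_sub_h2_mul_log_two hp₂₀ (by linarith)]
  have hpm : ∀ x y, 0 ≤ polarMinus W₁ W₂ x y := fun x y =>
    mul_nonneg (by norm_num) (sum_nonneg fun u _ => mul_nonneg (hc₁.1 _ _) (hc₂.1 _ _))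
  refine le_of_mul_le_mul_right ?_ (Real.log_pos one_lt_two)
  rw [capacity_mul_log_two hpm, one_sub_h2_mul_log_two (by nlinarith) (by nlinarith),
    Fintype.sum_prod_type_right]
  calc ∑ y₂, ∑ y₁, outputWeight (polarMinus W₁ W₂) (y₁, y₂) *
        biasInfo (posteriorBias (polarMinus W₁ W₂) (y₁, y₂))
      = ∑ y₂, outputWeight W₂ y₂ * ∑ y₁, outputWeight W₁ y₁ *
          biasInfo (posteriorBias W₂ y₂ * posteriorBias W₁ y₁) := by
        refine sum_congr rfl fun y₂ _ => ?_
        rw [mul_sum]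
        refine sum_congr rfl fun y₁ _ => ?_
        rw [outputWeight_polarMinus, posteriorBias_polarMinus,
          mul_comm (posteriorBias W₁ y₁), mul_comm (outputWeight W₁ y₁), mul_assoc]
    _ ≤ ∑ y₂, outputWeight W₂ y₂ * biasInfo ((1 - 2 * p₁) * posteriorBias W₂ y₂) := by
        refine sum_le_sum fun y₂ _ =>
          mul_le_mul_of_nonneg_left ?_ (outputWeight_nonneg hc₂.1 y₂)
        rw [mul_comm (1 - 2 * p₁)]
        exact sum_mul_biasInfo_mul_le (outputWeight_nonneg hc₁.1) (sum_outputWeight hc₁)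
          (abs_posteriorBias_le_one hc₁.1) (abs_posteriorBias_le_one hc₂.1 y₂) hs₁ hsum₁
    _ ≤ biasInfo ((1 - 2 * p₁) * (1 - 2 * p₂)) :=
        sum_mul_biasInfo_mul_le (outputWeight_nonneg hc₂.1) (sum_outputWeight hc₂)
          (abs_posteriorBias_le_one hc₂.1) ((abs_of_nonneg hs₁.1).trans_le hs₁.2) hs₂ hsum₂
    _ = biasInfo (1 - 2 * (p₁ * (1 - p₂) + (1 - p₁) * p₂)) := by
        congr 1
        ring
end
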